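/- arXiv:1612.06283 — 2 statements merged into one kernel-verified Lean document; each statement's English description precedes it below -/
import Mathlib

section
/- Let p ≥ 1, β > 0, and let Y : [0,∞) × ℝ^p → ℝ^p be continuous, bounded, and Lipschitz in the space variable uniformly in t. For i = 1, 2 let (ν^i_t)_{t ≥ 0} be weak*-continuous families of Borel probability measures on ℝ^p such that for every function φ : [0,∞) × ℝ^p → ℝ which is continuously differentiable in (t,x), twice continuously differentiable in x with (t,x) ↦ ∇²φ(t,x) continuous, which is bounded together with ∂ₜφ, ∇φ and ∇²φ, and which vanishes identically for all t larger than some T > 0, one has ∫_{ℝ^p} φ(0,x) dν^i_0(x) + ∫₀^∞ ( ∫_{ℝ^p} [ ∂ₜφ(t,x) + (1/(2β))·Δφ(t,x) + ⟨Y(t,x), ∇φ(t,x)⟩ ] dν^i_t(x) ) dt = 0. If ν¹_0 = ν²_0, then ν¹_t = ν²_t for every t ≥ 0. -/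
open MeasureTheory
open scoped RealInnerProductSpace NNReal

/-- The spatial Laplacian of `f : ℝ^p → ℝ`: the sum of the second derivatives in the
directions of the standard orthonormal basis (the trace of the Hessian). -/
noncomputable def laplacian {p : ℕ} (f : EuclideanSpace ℝ (Fin p) → ℝ)
    (x : EuclideanSpace ℝ (Fin p)) : ℝ :=
  ∑ i : Fin p,
    fderiv ℝ (fun y => fderiv ℝ f y (EuclideanSpace.single i 1)) x (EuclideanSpace.single i 1)


open Filter Topology



lemma time_lemma (m b : ℝ → ℝ) (hm : Continuous m) (hb : Continuous b)
    (H : ∀ χ χ' : ℝ → ℝ, (∀ t, HasDerivAt χ (χ' t) t) → Continuous χ' →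
      (∃ C, ∀ t, |χ t| ≤ C ∧ |χ' t| ≤ C) → (∃ T, 0 < T ∧ ∀ t, T ≤ t → χ t = 0) →
      χ 0 * m 0 + ∫ t in Set.Ici (0:ℝ), (χ' t * m t + χ t * b t) = 0) :
    ∀ t, 0 ≤ t → m t = m 0 + ∫ s in (0:ℝ)..t, b s := by
  intro t0 ht0
  set B : ℝ → ℝ := fun t => ∫ s in (0:ℝ)..t, b s with hB
  have hBd : ∀ t, HasDerivAt B (b t) t := fun t =>
    intervalIntegral.integral_hasDerivAt_right (hb.intervalIntegrable _ _)
      hb.aestronglyMeasurable.stronglyMeasurableAtFilter hb.continuousAt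
  have hBc : Continuous B := continuous_iff_continuousAt.2 fun t => (hBd t).continuousAt
  set r : ℝ → ℝ := fun t => m t - m 0 - B t with hr
  have hrc : Continuous r := by fun_prop
  set T := t0 + 1 with hT
  have hTpos : 0 < T := by linarith
  set η : ℝ → ℝ := fun t => r t * (max 0 (T - t) * max 0 (t + 1)) with hη
  have hηc : Continuous η := by fun_prop
  have hη1 : ∀ t, T ≤ t → η t = 0 := by
    intro t ht
    simp only [hη]; rw [max_eq_left (by linarith : T - t ≤ 0)]; simp
  have hη2 : ∀ t, t ≤ -1 → η t = 0 := by
    intro t ht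
    simp only [hη]; rw [max_eq_left (by linarith : t + 1 ≤ 0)]; simp
  have hηs : HasCompactSupport η := by
    refine HasCompactSupport.intro (K := Set.Icc (-1) T) isCompact_Icc ?_
    intro x hx
    by_cases h : x ≤ -1
    · exact hη2 x h
    · refine hη1 x ?_
      by_contra h'
      exact hx ⟨by linarith, by linarith⟩
  have hηi : Integrable η := hηc.integrable_of_hasCompactSupport hηs
  obtain ⟨C1, hC1⟩ := hηc.bounded_above_of_compact_support hηs
  set χ : ℝ → ℝ := fun t => ∫ s in T..t, η s with hχ
  have hχd : ∀ t, HasDerivAt χ (η t) t := fun t =>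
    intervalIntegral.integral_hasDerivAt_right (hηc.intervalIntegrable _ _)
      hηc.aestronglyMeasurable.stronglyMeasurableAtFilter hηc.continuousAt
  have hχc : Continuous χ := continuous_iff_continuousAt.2 fun t => (hχd t).continuousAt
  have hχ0 : ∀ t, T ≤ t → χ t = 0 := by
    intro t ht
    simp only [hχ]
    rw [intervalIntegral.integral_congr (g := fun _ => (0:ℝ))]
    · simp
    · intro s hs
      rw [Set.uIcc_of_le ht] at hs
      exact hη1 s hs.1
  have hχb : ∀ t, |χ t| ≤ ∫ s, ‖η s‖ := by
    intro t
    rw [← Real.norm_eq_abs]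
    refine (intervalIntegral.norm_integral_le_integral_norm_uIoc).trans ?_
    exact setIntegral_le_integral hηi.norm (Filter.Eventually.of_forall fun _ => norm_nonneg _)
  have h1 := H χ η hχd hηc ⟨max (∫ s, ‖η s‖) C1, fun t =>
    ⟨(hχb t).trans (le_max_left _ _), (hC1 t).trans (le_max_right _ _)⟩⟩ ⟨T, hTpos, hχ0⟩
  have h2 : ∫ t in Set.Ici (0:ℝ), (η t * m t + χ t * b t) =
      ∫ t in (0:ℝ)..T, (η t * m t + χ t * b t) := by
    rw [intervalIntegral.integral_of_le hTpos.le, ← integral_Icc_eq_integral_Ioc]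
    apply setIntegral_eq_of_subset_of_forall_sdiff_eq_zero measurableSet_Ici Set.Icc_subset_Ici_self
    intro x hx
    have : T ≤ x := by
      by_contra h
      exact hx.2 ⟨hx.1, by linarith⟩
    rw [hη1 x this, hχ0 x this]; simp
  have h3 : ∫ t in (0:ℝ)..T, (η t * (m 0 + B t) + χ t * b t) =
      χ T * (m 0 + B T) - χ 0 * (m 0 + B 0) := by
    apply intervalIntegral.integral_eq_sub_of_hasDerivAt (f := fun t => χ t * (m 0 + B t))
    · intro x _
      exact (hχd x).mul ((hBd x).const_add _)
    · exact Continuous.intervalIntegrable (by fun_prop) _ _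
  have hB0 : B 0 = 0 := by simp [hB]
  rw [hχ0 T le_rfl, hB0] at h3
  rw [h2] at h1
  have h4 : ∫ t in (0:ℝ)..T, η t * r t = 0 := by
    have : ∫ t in (0:ℝ)..T, η t * r t = (∫ t in (0:ℝ)..T, (η t * m t + χ t * b t)) -
      ∫ t in (0:ℝ)..T, (η t * (m 0 + B t) + χ t * b t) := by
      rw [← intervalIntegral.integral_sub]
      · congr 1; ext t; simp only [hr]; ring
      · exact Continuous.intervalIntegrable (by fun_prop) _ _
      · exact Continuous.intervalIntegrable (by fun_prop) _ _
    rw [this, h3]; linarith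
  have h5 : r t0 = 0 := by
    by_contra hne
    have : 0 < ∫ t in (0:ℝ)..T, η t * r t := by
      apply intervalIntegral.integral_pos hTpos (by fun_prop)
      · intro x hx
        have : η x * r x = (r x)^2 * (max 0 (T - x) * max 0 (x + 1)) := by simp only [hη]; ring
        rw [this]; positivity
      · refine ⟨t0, ⟨ht0, by linarith⟩, ?_⟩
        have : η t0 * r t0 = (r t0)^2 * (max 0 (T - t0) * max 0 (t0 + 1)) := by
          simp only [hη]; ring
        rw [this]
        have h6 : (0:ℝ) < max 0 (T - t0) := lt_max_of_lt_right (by linarith)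
        have h7 : (0:ℝ) < max 0 (t0 + 1) := lt_max_of_lt_right (by linarith)
        positivity
    linarith
  simp only [hr] at h5
  linarith


noncomputable def trigF {p : ℕ} (q : EuclideanSpace ℝ (Fin p) × ℝ)
    (x : EuclideanSpace ℝ (Fin p)) : ℝ := Real.cos (⟪q.1, x⟫ + q.2)

noncomputable def trigT (p : ℕ) : Submodule ℝ (EuclideanSpace ℝ (Fin p) → ℝ) :=
  Submodule.span ℝ (Set.range trigF)

lemma trigT_mul {p : ℕ} {f g : EuclideanSpace ℝ (Fin p) → ℝ} (hf : f ∈ trigT p)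
    (hg : g ∈ trigT p) : f * g ∈ trigT p := by
  unfold trigT at hf hg
  induction hf, hg using Submodule.span_induction₂ with
  | mem_mem x y hx hy =>
    obtain ⟨a, rfl⟩ := hx
    obtain ⟨b, rfl⟩ := hy
    have : trigF a * trigF b = (1/2 : ℝ) • trigF (a.1 + b.1, a.2 + b.2) +
        (1/2 : ℝ) • trigF (a.1 - b.1, a.2 - b.2) := by
      ext x
      simp only [trigF, Pi.mul_apply, Pi.add_apply, Pi.smul_apply, inner_add_left, inner_sub_left,
        smul_eq_mul]
      have e1 : ⟪a.1, x⟫ + ⟪b.1, x⟫ + (a.2 + b.2) = (⟪a.1, x⟫ + a.2) + (⟪b.1, x⟫ + b.2) := by ring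
      have e2 : ⟪a.1, x⟫ - ⟪b.1, x⟫ + (a.2 - b.2) = (⟪a.1, x⟫ + a.2) - (⟪b.1, x⟫ + b.2) := by ring
      rw [e1, e2, Real.cos_add (⟪a.1, x⟫ + a.2), Real.cos_sub (⟪a.1, x⟫ + a.2)]; ring
    rw [this]
    exact (trigT p).add_mem ((trigT p).smul_mem _ (Submodule.subset_span ⟨_, rfl⟩))
      ((trigT p).smul_mem _ (Submodule.subset_span ⟨_, rfl⟩))
  | zero_left y hy => simp
  | zero_right y hy => simp
  | add_left x y z _ _ _ h1 h2 => rw [add_mul]; exact (trigT p).add_mem h1 h2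
  | add_right x y z _ _ _ h1 h2 => rw [mul_add]; exact (trigT p).add_mem h1 h2
  | smul_left r x y _ _ h => rw [smul_mul_assoc]; exact (trigT p).smul_mem _ h
  | smul_right r x y _ _ h => rw [mul_smul_comm]; exact (trigT p).smul_mem _ h

noncomputable def sinMap {p : ℕ} (L : ℝ) (x : EuclideanSpace ℝ (Fin p)) :
    EuclideanSpace ℝ (Fin p) := WithLp.toLp 2 fun i => Real.sin (x i / L)

lemma sinMap_cont {p : ℕ} (L : ℝ) : Continuous (sinMap (p := p) L) := by
  unfold sinMap; fun_prop

noncomputable def sinAlg (p : ℕ) (L : ℝ) : Subalgebra ℝ C(EuclideanSpace ℝ (Fin p), ℝ) where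
  carrier := {h | (fun x => h (sinMap L x)) ∈ trigT p}
  mul_mem' := fun {a b} ha hb => trigT_mul ha hb
  add_mem' := fun {a b} ha hb => (trigT p).add_mem ha hb
  algebraMap_mem' := by
    intro r
    have : (fun x => (algebraMap ℝ C(EuclideanSpace ℝ (Fin p), ℝ) r) (sinMap L x)) =
      r • trigF (p := p) (0, 0) := by
      ext x; simp [trigF]
    show _ ∈ trigT p
    rw [this]
    exact (trigT p).smul_mem _ (Submodule.subset_span ⟨_, rfl⟩)

lemma sinAlg_sep (p : ℕ) (L : ℝ) : (sinAlg p L).SeparatesPoints := by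
  intro x y hxy
  obtain ⟨i, hi⟩ : ∃ i, x i ≠ y i := by
    by_contra h
    push Not at h
    exact hxy (by ext i; exact h i)
  refine ⟨_, ⟨⟨fun z => z i, by fun_prop⟩, ?_, rfl⟩, hi⟩
  show (fun x => (sinMap L x) i) ∈ trigT p
  have : (fun x => (sinMap L x) i) = trigF (p := p) (EuclideanSpace.single i (1/L), -(Real.pi/2)) := by
    ext x
    simp only [sinMap, trigF, EuclideanSpace.inner_single_left]
    rw [← sub_eq_add_neg, Real.cos_sub_pi_div_two]
    congr 1; simp; ring
  rw [this]
  exact Submodule.subset_span ⟨_, rfl⟩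

lemma sinMap_norm {p : ℕ} (L : ℝ) (x : EuclideanSpace ℝ (Fin p)) :
    sinMap L x ∈ Metric.closedBall (0 : EuclideanSpace ℝ (Fin p)) (Real.sqrt p) := by
  rw [mem_closedBall_zero_iff, EuclideanSpace.norm_eq]
  apply Real.sqrt_le_sqrt
  calc ∑ i, ‖sinMap L x i‖^2 ≤ ∑ i : Fin p, (1:ℝ) := by
        apply Finset.sum_le_sum
        intro i _
        have := Real.abs_sin_le_one (x i / L)
        simp only [sinMap, Real.norm_eq_abs]
        nlinarith [abs_nonneg (Real.sin (x i / L))]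
    _ = p := by simp

lemma sinMap_tendsto {p : ℕ} (x : EuclideanSpace ℝ (Fin p)) :
    Tendsto (fun n : ℕ => ((n : ℝ) + 1) • sinMap ((n : ℝ) + 1) x) atTop (𝓝 x) := by
  have key : ∀ a : ℝ, Tendsto (fun n : ℕ => ((n : ℝ) + 1) * Real.sin (a / ((n : ℝ) + 1))) atTop
      (𝓝 a) := by
    intro a
    have h1 : HasDerivAt (fun h : ℝ => Real.sin (a * h)) a 0 := by
      have := (((hasDerivAt_id (0:ℝ)).const_mul a).sin)
      simpa using this
    have h2 := (hasDerivAt_iff_tendsto_slope_zero.1 h1)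
    have h3 : Tendsto (fun n : ℕ => 1 / ((n : ℝ) + 1)) atTop (𝓝[≠] 0) := by
      rw [tendsto_nhdsWithin_iff]
      refine ⟨tendsto_one_div_add_atTop_nhds_zero_nat, Eventually.of_forall fun n => ?_⟩
      have : (0:ℝ) < 1 / ((n : ℝ) + 1) := by positivity
      exact this.ne'
    have h4 := h2.comp h3
    refine h4.congr fun n => ?_
    simp [div_eq_mul_inv]
  have h : Tendsto (fun n : ℕ => WithLp.toLp 2
      (fun i => ((n : ℝ) + 1) * Real.sin (x i / ((n : ℝ) + 1)))) atTop
      (𝓝 (WithLp.toLp 2 (fun i => x i))) :=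
    ((PiLp.continuous_toLp 2 _).tendsto _).comp (tendsto_pi_nhds.2 fun i => key (x i))
  exact h

lemma trigT_cont {p : ℕ} {f : EuclideanSpace ℝ (Fin p) → ℝ} (hf : f ∈ trigT p) :
    Continuous f := by
  unfold trigT at hf
  induction hf using Submodule.span_induction with
  | mem x hx =>
    obtain ⟨a, rfl⟩ := hx
    unfold trigF; fun_prop
  | zero => exact continuous_const
  | add x y _ _ h1 h2 => exact h1.add h2
  | smul r x _ h => exact h.const_smul r

/-- integrals against trig polynomials control integrals of bounded continuous functions -/
lemma density {p : ℕ} (μ ν : Measure (EuclideanSpace ℝ (Fin p))) [IsProbabilityMeasure μ]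
    [IsProbabilityMeasure ν] (S : ℝ)
    (H : ∀ f ∈ trigT p, ∀ c : ℝ, 0 ≤ c → (∀ x, |f x| ≤ c) →
      |∫ x, f x ∂μ - ∫ x, f x ∂ν| ≤ S * c)
    (g : EuclideanSpace ℝ (Fin p) → ℝ) (hg : Continuous g) (c : ℝ) (hc : 0 ≤ c)
    (hgc : ∀ x, |g x| ≤ c) : |∫ x, g x ∂μ - ∫ x, g x ∂ν| ≤ S * c := by
  have hint : ∀ (κ : Measure (EuclideanSpace ℝ (Fin p))) [IsProbabilityMeasure κ]
      (f : EuclideanSpace ℝ (Fin p) → ℝ), Continuous f → ∀ C, (∀ x, |f x| ≤ C) →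
      Integrable f κ := fun κ _ f hf C hC =>
    Integrable.of_bound hf.aestronglyMeasurable C (Eventually.of_forall hC)
  -- step 1: sin composed
  have step1 : ∀ L : ℝ, |∫ x, g (L • sinMap L x) ∂μ - ∫ x, g (L • sinMap L x) ∂ν| ≤ S * c := by
    intro L
    have hGc : Continuous fun x => g (L • sinMap (p := p) L x) :=
      hg.comp ((sinMap_cont L).const_smul L)
    have key : ∀ ε > 0, |∫ x, g (L • sinMap L x) ∂μ - ∫ x, g (L • sinMap L x) ∂ν| ≤
        S * (c + ε) + 2 * ε := by
      intro ε hε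
      obtain ⟨h, hh, hh'⟩ :=
        ContinuousMap.exists_mem_subalgebra_near_continuous_of_isCompact_of_separatesPoints
        (sinAlg_sep p L) ⟨fun z => g (L • z), by fun_prop⟩
        (isCompact_closedBall (0 : EuclideanSpace ℝ (Fin p)) (Real.sqrt p)) hε
      set f : EuclideanSpace ℝ (Fin p) → ℝ := fun x => h (sinMap L x) with hf
      have hfT : f ∈ trigT p := hh
      have hfg : ∀ x, |f x - g (L • sinMap L x)| ≤ ε := fun x => (hh' _ (sinMap_norm L x)).le
      have hfb : ∀ x, |f x| ≤ c + ε := by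
        intro x
        have := abs_add_le (f x - g (L • sinMap L x)) (g (L • sinMap L x))
        simp only [sub_add_cancel] at this
        linarith [hfg x, hgc (L • sinMap L x)]
      have h1 := H f hfT (c + ε) (by linarith) hfb
      have h2 : ∀ (κ : Measure (EuclideanSpace ℝ (Fin p))) [IsProbabilityMeasure κ],
          |∫ x, f x ∂κ - ∫ x, g (L • sinMap L x) ∂κ| ≤ ε := by
        intro κ _
        rw [← integral_sub (hint κ f (trigT_cont hfT) _ hfb) (hint κ _ hGc c fun x => hgc _)]
        have := norm_integral_le_of_norm_le_const (μ := κ)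
          (Eventually.of_forall hfg : ∀ᵐ x ∂κ, ‖f x - g (L • sinMap L x)‖ ≤ ε)
        simpa using this
      have h3 := h2 μ
      have h4 := h2 ν
      rw [abs_le] at *
      constructor <;> linarith [h1.1, h1.2, h3.1, h3.2, h4.1, h4.2]
    have hlim : Tendsto (fun ε : ℝ => S * (c + ε) + 2 * ε) (𝓝[>] 0) (𝓝 (S * (c + 0) + 2 * 0)) :=
      (Continuous.tendsto (by fun_prop) 0).mono_left nhdsWithin_le_nhds
    have := ge_of_tendsto hlim (eventually_nhdsWithin_of_forall fun ε hε => key ε hε)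
    simpa using this
  have lim : ∀ (κ : Measure (EuclideanSpace ℝ (Fin p))) [IsProbabilityMeasure κ],
      Tendsto (fun n : ℕ => ∫ x, g (((n : ℝ) + 1) • sinMap ((n : ℝ) + 1) x) ∂κ) atTop
        (𝓝 (∫ x, g x ∂κ)) := by
    intro κ _
    apply tendsto_integral_of_dominated_convergence (fun _ => c)
    · intro n
      exact (hg.comp ((sinMap_cont ((n : ℝ) + 1)).const_smul ((n : ℝ) + 1))).aestronglyMeasurable
    · exact integrable_const _
    · intro n; exact Eventually.of_forall fun x => hgc _
    · exact Eventually.of_forall fun x => (hg.tendsto x).comp (sinMap_tendsto x)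
  exact le_of_tendsto ((lim μ).sub (lim ν)).abs (Eventually.of_forall fun n => step1 _)

lemma weak_cont {p : ℕ} (κ : ℝ → Measure (EuclideanSpace ℝ (Fin p)))
    (hprob : ∀ t ∈ Set.Ici (0 : ℝ), IsProbabilityMeasure (κ t))
    (hwk : ∀ f : EuclideanSpace ℝ (Fin p) → ℝ, Continuous f → (∃ C, ∀ x, |f x| ≤ C) →
      ContinuousOn (fun t => ∫ x, f x ∂(κ t)) (Set.Ici (0 : ℝ)))
    (g : ℝ → EuclideanSpace ℝ (Fin p) → ℝ)
    (hg : Continuous fun q : ℝ × EuclideanSpace ℝ (Fin p) => g q.1 q.2) (C : ℝ)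
    (hC : ∀ t ∈ Set.Ici (0 : ℝ), ∀ x, |g t x| ≤ C) :
    ContinuousOn (fun t => ∫ x, g t x ∂(κ t)) (Set.Ici (0 : ℝ)) := by
  intro t0 ht0
  have hC0 : 0 ≤ C := (abs_nonneg _).trans (hC 0 Set.self_mem_Ici 0)
  have hgt : ∀ t, Continuous (g t) := fun t => hg.comp (by fun_prop : Continuous fun x => (t, x))
  set ψ : ℕ → EuclideanSpace ℝ (Fin p) → ℝ := fun n x => min 1 (max 0 (‖x‖ - n)) with hψ
  have hψc : ∀ n, Continuous (ψ n) := fun n => by simp only [hψ]; fun_prop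
  have hψ0 : ∀ n x, 0 ≤ ψ n x := fun n x => by simp only [hψ]; positivity
  have hψ1 : ∀ n x, ψ n x ≤ 1 := fun n x => min_le_left _ _
  have hψb : ∀ n x, |ψ n x| ≤ 1 := fun n x => by rw [abs_of_nonneg (hψ0 n x)]; exact hψ1 n x
  have hlim : Tendsto (fun n => ∫ x, ψ n x ∂(κ t0)) atTop (𝓝 (∫ x, (0:ℝ) ∂(κ t0))) := by
    have := hprob t0 ht0
    apply tendsto_integral_of_dominated_convergence (fun _ => 1)
    · intro n; exact (hψc n).aestronglyMeasurable
    · exact integrable_const _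
    · intro n; exact Eventually.of_forall (hψb n)
    · refine Eventually.of_forall fun x => ?_
      obtain ⟨N, hN⟩ := exists_nat_ge ‖x‖
      refine tendsto_const_nhds.congr' ?_
      filter_upwards [eventually_ge_atTop N] with n hn
      have : (N : ℝ) ≤ n := by exact_mod_cast hn
      simp only [hψ]
      rw [max_eq_left (by linarith)]; simp
  rw [integral_zero] at hlim
  rw [ContinuousWithinAt, Metric.tendsto_nhds]
  intro ε' hε'
  set ε := ε' / (2 * C + 3) with hε_def
  have hε : 0 < ε := by positivity
  obtain ⟨n, hn⟩ := (hlim.eventually (gt_mem_nhds hε)).exists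
  have e1 : ∀ᶠ t in 𝓝[Set.Ici 0] t0, ∫ x, ψ n x ∂(κ t) < ε :=
    (hwk (ψ n) (hψc n) ⟨1, hψb n⟩ t0 ht0).eventually (gt_mem_nhds hn)
  have e2 : ∀ᶠ t in 𝓝[Set.Ici 0] t0, ∀ x ∈ Metric.closedBall (0 : EuclideanSpace ℝ (Fin p)) (n+1),
      |g t x - g t0 x| < ε := by
    apply Filter.Eventually.filter_mono nhdsWithin_le_nhds
    apply (isCompact_closedBall (0 : EuclideanSpace ℝ (Fin p)) ((n:ℝ)+1)).eventually_forall_of_forall_eventually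
    intro x _
    have hc : Continuous fun q : ℝ × EuclideanSpace ℝ (Fin p) => |g q.1 q.2 - g t0 q.2| := by
      have := (hgt t0)
      fun_prop
    have := hc.tendsto (t0, x)
    simp only [sub_self, abs_zero] at this
    exact this.eventually (gt_mem_nhds hε)
  have e3 : ∀ᶠ t in 𝓝[Set.Ici 0] t0, |∫ x, g t0 x ∂(κ t) - ∫ x, g t0 x ∂(κ t0)| < ε := by
    have := (hwk (g t0) (hgt t0) ⟨C, hC t0 ht0⟩ t0 ht0)
    exact (Metric.tendsto_nhds.1 this) ε hε
  filter_upwards [e1, e2, e3, self_mem_nhdsWithin] with t h1 h2 h3 ht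
  have := hprob t ht
  have hint : ∀ f : EuclideanSpace ℝ (Fin p) → ℝ, Continuous f → ∀ C, (∀ x, |f x| ≤ C) →
      Integrable f (κ t) := fun f hf C hC =>
    Integrable.of_bound hf.aestronglyMeasurable C (Eventually.of_forall hC)
  have h4 : |∫ x, g t x ∂(κ t) - ∫ x, g t0 x ∂(κ t)| ≤ ε + 2 * C * ε := by
    rw [← integral_sub (hint _ (hgt t) C (hC t ht)) (hint _ (hgt t0) C (hC t0 ht0))]
    have hle : ∀ x, ‖g t x - g t0 x‖ ≤ ε + 2 * C * ψ n x := by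
      intro x
      rw [Real.norm_eq_abs]
      by_cases hx : ‖x‖ ≤ n + 1
      · have := h2 x (by simpa using hx)
        have := mul_nonneg (mul_nonneg zero_le_two hC0) (hψ0 n x)
        linarith
      · have : ψ n x = 1 := by
          simp only [hψ]
          rw [max_eq_right (by linarith), min_eq_left (by linarith)]
        rw [this]
        have a1 := hC t ht x
        have a2 := hC t0 ht0 x
        have := abs_sub (g t x) (g t0 x)
        linarith
    have hψi := hint _ (hψc n) 1 (hψb n)
    have := norm_integral_le_of_norm_le (μ := κ t) (g := fun x => ε + 2 * C * ψ n x)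
      ((integrable_const ε).add (hψi.const_mul (2*C))) (Eventually.of_forall hle)
    refine this.trans ?_
    have e : ∫ x, (ε + 2 * C * ψ n x) ∂(κ t) = ε + 2 * C * ∫ x, ψ n x ∂(κ t) := by
      rw [integral_add (integrable_const ε) (hψi.const_mul (2*C)), integral_const_mul]
      simp
    rw [e]
    gcongr
  rw [Real.dist_eq]
  have h5 := abs_sub_le (∫ x, g t x ∂(κ t)) (∫ x, g t0 x ∂(κ t)) (∫ x, g t0 x ∂(κ t0))
  have h6 : ε * (2 * C + 3) = ε' := by rw [hε_def]; field_simp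
  nlinarith

lemma trig_fd {p : ℕ} (c : ℝ) (q : EuclideanSpace ℝ (Fin p) × ℝ) (x : EuclideanSpace ℝ (Fin p)) :
    HasFDerivAt (fun x => c * trigF q x) ((-(c * Real.sin (⟪q.1, x⟫ + q.2))) • innerSL ℝ q.1) x := by
  have hlin : HasFDerivAt (fun x => ⟪q.1, x⟫ + q.2) (innerSL ℝ q.1) x :=
    (innerSL ℝ q.1).hasFDerivAt.add_const q.2
  have := (hlin.cos).const_mul c
  exact this.congr_fderiv (by rw [smul_smul]; congr 1; ring)

lemma trig_fs {p : ℕ} (c : ℝ) (q : EuclideanSpace ℝ (Fin p) × ℝ) (x : EuclideanSpace ℝ (Fin p)) :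
    HasFDerivAt (fun x => -(c * Real.sin (⟪q.1, x⟫ + q.2))) ((-(c * trigF q x)) • innerSL ℝ q.1) x := by
  have hlin : HasFDerivAt (fun x => ⟪q.1, x⟫ + q.2) (innerSL ℝ q.1) x :=
    (innerSL ℝ q.1).hasFDerivAt.add_const q.2
  have := ((hlin.sin).const_mul c).neg
  exact this.congr_fderiv (by rw [smul_smul, ← neg_smul]; rfl)

lemma trig_grad {p : ℕ} (c : ℝ) (q : EuclideanSpace ℝ (Fin p) × ℝ) :
    gradient (fun x => c * trigF q x) = fun x => (-(c * Real.sin (⟪q.1, x⟫ + q.2))) • q.1 := by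
  ext1 x
  apply HasGradientAt.gradient
  rw [hasGradientAt_iff_hasFDerivAt]
  refine (trig_fd c q x).congr_fderiv (ContinuousLinearMap.ext fun y => ?_)
  simp

lemma trig_hess {p : ℕ} (c : ℝ) (q : EuclideanSpace ℝ (Fin p) × ℝ) (x : EuclideanSpace ℝ (Fin p)) :
    fderiv ℝ (fun y => gradient (fun x => c * trigF q x) y) x =
      (-(c * trigF q x)) • (innerSL ℝ q.1).smulRight q.1 := by
  simp only [trig_grad]
  rw [((trig_fs c q x).smul_const q.1).fderiv]
  refine ContinuousLinearMap.ext fun y => ?_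
  simp [smul_smul]

lemma trig_lap {p : ℕ} (c : ℝ) (q : EuclideanSpace ℝ (Fin p) × ℝ) (x : EuclideanSpace ℝ (Fin p)) :
    laplacian (fun x => c * trigF q x) x = -(c * trigF q x) * ‖q.1‖^2 := by
  unfold laplacian
  have e1 : ∀ i : Fin p, (fun y => fderiv ℝ (fun x => c * trigF q x) y (EuclideanSpace.single i 1)) =
      fun y => (-(c * Real.sin (⟪q.1, y⟫ + q.2))) * q.1 i := by
    intro i; ext y
    rw [(trig_fd c q y).fderiv]
    simp [EuclideanSpace.inner_single_right]
  have e2 : ∀ i : Fin p, fderiv ℝ (fun y => fderiv ℝ (fun x => c * trigF q x) y (EuclideanSpace.single i 1)) x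
      (EuclideanSpace.single i 1) = -(c * trigF q x) * (q.1 i)^2 := by
    intro i
    rw [e1 i, ((trig_fs c q x).mul_const (q.1 i)).fderiv]
    simp [EuclideanSpace.inner_single_right]
    ring
  rw [Finset.sum_congr rfl fun i _ => e2 i, ← Finset.mul_sum, EuclideanSpace.norm_sq_eq]
  simp

lemma weak_test {p : ℕ} (β : ℝ)
    (Y : ℝ → EuclideanSpace ℝ (Fin p) → EuclideanSpace ℝ (Fin p))
    (hYcont : Continuous fun q : ℝ × EuclideanSpace ℝ (Fin p) => Y q.1 q.2)
    (M : ℝ) (hM : ∀ t ∈ Set.Ici (0 : ℝ), ∀ x, ‖Y t x‖ ≤ M)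
    (κ : ℝ → Measure (EuclideanSpace ℝ (Fin p)))
    (hprob : ∀ t ∈ Set.Ici (0 : ℝ), IsProbabilityMeasure (κ t))
    (hwk : ∀ f : EuclideanSpace ℝ (Fin p) → ℝ, Continuous f → (∃ C, ∀ x, |f x| ≤ C) →
      ContinuousOn (fun t => ∫ x, f x ∂(κ t)) (Set.Ici (0 : ℝ)))
    (hweak : ∀ φ : ℝ → EuclideanSpace ℝ (Fin p) → ℝ,
      ContDiff ℝ 1 (fun q : ℝ × EuclideanSpace ℝ (Fin p) => φ q.1 q.2) →
      (∀ t, ContDiff ℝ 2 (φ t)) →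
      Continuous (fun q : ℝ × EuclideanSpace ℝ (Fin p) =>
        fderiv ℝ (fun y => gradient (φ q.1) y) q.2) →
      (∃ C, ∀ t x, |φ t x| ≤ C ∧ |deriv (fun s => φ s x) t| ≤ C ∧
        ‖gradient (φ t) x‖ ≤ C ∧ ‖fderiv ℝ (fun y => gradient (φ t) y) x‖ ≤ C) →
      (∃ T, 0 < T ∧ ∀ t, T ≤ t → ∀ x, φ t x = 0) →
      (∫ x, φ 0 x ∂(κ 0)) +
        (∫ t in Set.Ici (0 : ℝ),
          ∫ x, (deriv (fun s => φ s x) t + (1 / (2 * β)) * laplacian (φ t) x +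
            ⟪Y t x, gradient (φ t) x⟫) ∂(κ t)) = 0)
    (q : EuclideanSpace ℝ (Fin p) × ℝ) (χ χ' : ℝ → ℝ) (hχ : ∀ t, HasDerivAt χ (χ' t) t)
    (hχ'c : Continuous χ') (C : ℝ) (hC : ∀ t, |χ t| ≤ C ∧ |χ' t| ≤ C)
    (T : ℝ) (hT : 0 < T) (hT0 : ∀ t, T ≤ t → χ t = 0) :
    χ 0 * (∫ x, trigF q x ∂(κ 0)) + ∫ t in Set.Ici (0:ℝ), (χ' t * (∫ x, trigF q x ∂(κ t)) +
      χ t * (-(1 / (2 * β) * ‖q.1‖^2) * (∫ x, trigF q x ∂(κ t)) + (∫ x, -(Real.sin (⟪q.1, x⟫ + q.2)) * ⟪Y t x, q.1⟫ ∂(κ t)))) = 0 := by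
  have hM0 : 0 ≤ M := (norm_nonneg _).trans (hM 0 Set.self_mem_Ici 0)
  have htc : Continuous (trigF q) := by unfold trigF; fun_prop
  have htb : ∀ x, |trigF q x| ≤ 1 := fun x => Real.abs_cos_le_one _
  have hGc : Continuous fun w : ℝ × EuclideanSpace ℝ (Fin p) =>
      -(Real.sin (⟪q.1, w.2⟫ + q.2)) * ⟪Y w.1 w.2, q.1⟫ := by fun_prop
  have hGc2 : ∀ t : ℝ, Continuous fun x : EuclideanSpace ℝ (Fin p) =>
      -(Real.sin (⟪q.1, x⟫ + q.2)) * ⟪Y t x, q.1⟫ := by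
    intro t
    have hy : Continuous (Y t) := by fun_prop
    fun_prop
  have hGb : ∀ t ∈ Set.Ici (0:ℝ), ∀ x, |-(Real.sin (⟪q.1, x⟫ + q.2)) * ⟪Y t x, q.1⟫| ≤ M * ‖q.1‖ := by
    intro t ht x
    rw [abs_mul, abs_neg]
    have h1 := Real.abs_sin_le_one (⟪q.1, x⟫ + q.2)
    have h2 := abs_real_inner_le_norm (Y t x) q.1
    calc _ ≤ 1 * (‖Y t x‖ * ‖q.1‖) := by gcongr
      _ ≤ _ := by rw [one_mul]; gcongr; exact hM t ht x
  have hint : ∀ t ∈ Set.Ici (0:ℝ), ∀ f : EuclideanSpace ℝ (Fin p) → ℝ, Continuous f →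
      ∀ C, (∀ x, |f x| ≤ C) → Integrable f (κ t) := fun t ht f hf C hC =>
    have := hprob t ht
    Integrable.of_bound hf.aestronglyMeasurable C (Eventually.of_forall hC)
  have hC0 : 0 ≤ C := (abs_nonneg _).trans (hC 0).1
  have hχ1 : ContDiff ℝ 1 χ := by
    rw [contDiff_one_iff_deriv]
    refine ⟨fun t => (hχ t).differentiableAt, ?_⟩
    have : deriv χ = χ' := by ext t; exact (hχ t).deriv
    rwa [this]
  have hχc : Continuous χ := hχ1.continuous
  obtain ⟨φ, hφ⟩ : ∃ φ : ℝ → EuclideanSpace ℝ (Fin p) → ℝ, φ = fun t x => χ t * trigF q x := ⟨_, rfl⟩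
  have hφd : ∀ t x, deriv (fun s => φ s x) t = χ' t * trigF q x := by
    intro t x
    rw [hφ]
    exact ((hχ t).mul_const _).deriv
  have hφg : ∀ t, gradient (φ t) = fun x => (-(χ t * Real.sin (⟪q.1, x⟫ + q.2))) • q.1 :=
    fun t => by rw [hφ]; exact trig_grad (χ t) q
  have hφh : ∀ t x, fderiv ℝ (fun y => gradient (φ t) y) x =
      (-(χ t * trigF q x)) • (innerSL ℝ q.1).smulRight q.1 := fun t x => by rw [hφ]; exact trig_hess (χ t) q x
  have hlap : ∀ t x, laplacian (φ t) x = -(χ t * trigF q x) * ‖q.1‖^2 :=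
    fun t x => by rw [hφ]; exact trig_lap (χ t) q x
  have hw := hweak φ
    (by
      simp only [hφ, trigF]
      exact (hχ1.comp contDiff_fst).mul (Real.contDiff_cos.comp
        ((contDiff_const.inner ℝ contDiff_snd).add contDiff_const)))
    (by
      intro t
      simp only [hφ, trigF]
      exact contDiff_const.mul (Real.contDiff_cos.comp
        ((contDiff_const.inner ℝ contDiff_id).add contDiff_const)))
    (by
      simp only [hφh]
      fun_prop)
    (by
      refine ⟨max C (max (C * ‖q.1‖) (C * ‖(innerSL ℝ q.1).smulRight q.1‖)), fun t x => ?_⟩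
      have a1 := (hC t).1
      have a2 := (hC t).2
      have a3 := htb x
      have a4 := Real.abs_sin_le_one (⟪q.1, x⟫ + q.2)
      refine ⟨le_max_of_le_left ?_, le_max_of_le_left ?_, le_max_of_le_right (le_max_of_le_left ?_),
        le_max_of_le_right (le_max_of_le_right ?_)⟩
      · simp only [hφ]; rw [abs_mul]
        calc _ ≤ C * 1 := by gcongr
          _ = C := mul_one _
      · rw [hφd, abs_mul]
        calc _ ≤ C * 1 := by gcongr
          _ = C := mul_one _
      · rw [hφg, norm_smul, norm_neg, norm_mul, Real.norm_eq_abs, Real.norm_eq_abs]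
        gcongr
        calc _ ≤ C * 1 := by gcongr
          _ = C := mul_one _
      · rw [hφh, norm_smul, norm_neg, norm_mul, Real.norm_eq_abs, Real.norm_eq_abs]
        gcongr
        calc _ ≤ C * 1 := by gcongr
          _ = C := mul_one _)
    ⟨T, hT, fun t ht x => by simp [hφ, hT0 t ht]⟩
  have h1 : ∫ x, φ 0 x ∂(κ 0) = χ 0 * (∫ x, trigF q x ∂(κ 0)) := by
    rw [hφ]; exact integral_const_mul _ _
  rw [h1] at hw
  have hpt : ∀ t ∈ Set.Ici (0:ℝ), ∫ x, (deriv (fun s => φ s x) t + (1 / (2 * β)) * laplacian (φ t) x +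
            ⟪Y t x, gradient (φ t) x⟫) ∂(κ t) = χ' t * (∫ x, trigF q x ∂(κ t)) +
      χ t * (-(1 / (2 * β) * ‖q.1‖^2) * (∫ x, trigF q x ∂(κ t)) + (∫ x, -(Real.sin (⟪q.1, x⟫ + q.2)) * ⟪Y t x, q.1⟫ ∂(κ t))) := by
    intro t ht
    have e : (fun x => deriv (fun s => φ s x) t + (1 / (2 * β)) * laplacian (φ t) x +
              ⟪Y t x, gradient (φ t) x⟫) = fun x => (χ' t - χ t * (1 / (2 * β) * ‖q.1‖^2)) * trigF q x +
              χ t * (-(Real.sin (⟪q.1, x⟫ + q.2)) * ⟪Y t x, q.1⟫) := by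
      funext x
      rw [hφd, hlap, hφg, inner_smul_right]; ring
    rw [e]
    have hi2 : Integrable (fun x => -(Real.sin (⟪q.1, x⟫ + q.2)) * ⟪Y t x, q.1⟫) (κ t) :=
        hint t ht _ (hGc2 t) _ (hGb t ht)
    have hi1 : Integrable (trigF q) (κ t) := hint t ht _ htc 1 htb
    rw [integral_add (hi1.const_mul _) (hi2.const_mul _),
        integral_const_mul, integral_const_mul]
    generalize (∫ x, trigF q x ∂(κ t)) = u
    generalize (∫ x, -(Real.sin (⟪q.1, x⟫ + q.2)) * ⟪Y t x, q.1⟫ ∂(κ t)) = v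
    ring
  rw [setIntegral_congr_fun measurableSet_Ici hpt] at hw
  exact hw

set_option maxHeartbeats 400000 in
lemma weak_ode {p : ℕ} (β : ℝ)
    (Y : ℝ → EuclideanSpace ℝ (Fin p) → EuclideanSpace ℝ (Fin p))
    (hYcont : Continuous fun q : ℝ × EuclideanSpace ℝ (Fin p) => Y q.1 q.2)
    (M : ℝ) (hM : ∀ t ∈ Set.Ici (0 : ℝ), ∀ x, ‖Y t x‖ ≤ M)
    (κ : ℝ → Measure (EuclideanSpace ℝ (Fin p)))
    (hprob : ∀ t ∈ Set.Ici (0 : ℝ), IsProbabilityMeasure (κ t))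
    (hwk : ∀ f : EuclideanSpace ℝ (Fin p) → ℝ, Continuous f → (∃ C, ∀ x, |f x| ≤ C) →
      ContinuousOn (fun t => ∫ x, f x ∂(κ t)) (Set.Ici (0 : ℝ)))
    (hweak : ∀ φ : ℝ → EuclideanSpace ℝ (Fin p) → ℝ,
      ContDiff ℝ 1 (fun q : ℝ × EuclideanSpace ℝ (Fin p) => φ q.1 q.2) →
      (∀ t, ContDiff ℝ 2 (φ t)) →
      Continuous (fun q : ℝ × EuclideanSpace ℝ (Fin p) =>
        fderiv ℝ (fun y => gradient (φ q.1) y) q.2) →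
      (∃ C, ∀ t x, |φ t x| ≤ C ∧ |deriv (fun s => φ s x) t| ≤ C ∧
        ‖gradient (φ t) x‖ ≤ C ∧ ‖fderiv ℝ (fun y => gradient (φ t) y) x‖ ≤ C) →
      (∃ T, 0 < T ∧ ∀ t, T ≤ t → ∀ x, φ t x = 0) →
      (∫ x, φ 0 x ∂(κ 0)) +
        (∫ t in Set.Ici (0 : ℝ),
          ∫ x, (deriv (fun s => φ s x) t + (1 / (2 * β)) * laplacian (φ t) x +
            ⟪Y t x, gradient (φ t) x⟫) ∂(κ t)) = 0)
    (q : EuclideanSpace ℝ (Fin p) × ℝ) (t : ℝ) (ht : 0 ≤ t) :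
    HasDerivWithinAt (fun t => ∫ x, trigF q x ∂(κ t))
      (-(1 / (2 * β) * ‖q.1‖^2) * (∫ x, trigF q x ∂(κ t)) +
        ∫ x, -(Real.sin (⟪q.1, x⟫ + q.2)) * ⟪Y t x, q.1⟫ ∂(κ t)) (Set.Ici t) t := by
  have hM0 : 0 ≤ M := (norm_nonneg _).trans (hM 0 Set.self_mem_Ici 0)
  have htc : Continuous (trigF q) := by unfold trigF; fun_prop
  have htb : ∀ x, |trigF q x| ≤ 1 := fun x => Real.abs_cos_le_one _
  have hGc : Continuous fun w : ℝ × EuclideanSpace ℝ (Fin p) =>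
      -(Real.sin (⟪q.1, w.2⟫ + q.2)) * ⟪Y w.1 w.2, q.1⟫ := by fun_prop
  have hGc2 : ∀ t : ℝ, Continuous fun x : EuclideanSpace ℝ (Fin p) =>
      -(Real.sin (⟪q.1, x⟫ + q.2)) * ⟪Y t x, q.1⟫ := by
    intro t
    have hy : Continuous (Y t) := by fun_prop
    fun_prop
  have hGb : ∀ t ∈ Set.Ici (0:ℝ), ∀ x, |-(Real.sin (⟪q.1, x⟫ + q.2)) * ⟪Y t x, q.1⟫| ≤ M * ‖q.1‖ := by
    intro t ht x
    rw [abs_mul, abs_neg]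
    have h1 := Real.abs_sin_le_one (⟪q.1, x⟫ + q.2)
    have h2 := abs_real_inner_le_norm (Y t x) q.1
    calc _ ≤ 1 * (‖Y t x‖ * ‖q.1‖) := by gcongr
      _ ≤ _ := by rw [one_mul]; gcongr; exact hM t ht x
  have hint : ∀ t ∈ Set.Ici (0:ℝ), ∀ f : EuclideanSpace ℝ (Fin p) → ℝ, Continuous f →
      ∀ C, (∀ x, |f x| ≤ C) → Integrable f (κ t) := fun t ht f hf C hC =>
    have := hprob t ht
    Integrable.of_bound hf.aestronglyMeasurable C (Eventually.of_forall hC)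
  set m : ℝ → ℝ := fun t => ∫ x, trigF q x ∂(κ t) with hm
  set G : ℝ → ℝ := fun t => ∫ x, -(Real.sin (⟪q.1, x⟫ + q.2)) * ⟪Y t x, q.1⟫ ∂(κ t) with hG
  have hmc : ContinuousOn m (Set.Ici 0) := hwk _ htc ⟨1, htb⟩
  have hGcont : ContinuousOn G (Set.Ici 0) := weak_cont κ hprob hwk _ hGc _ hGb
  set lam := 1 / (2 * β) * ‖q.1‖^2 with hlam
  set b : ℝ → ℝ := fun t => -lam * m t + G t with hb
  have hbc : ContinuousOn b (Set.Ici 0) := (continuousOn_const.mul hmc).add hGcont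
  have hmax : Continuous fun t : ℝ => max t 0 := by fun_prop
  have hmm : Continuous fun t => m (max t 0) := hmc.comp_continuous hmax fun t => Set.mem_Ici.2 (le_max_right _ _)
  have hbb : Continuous fun t => b (max t 0) := hbc.comp_continuous hmax fun t => Set.mem_Ici.2 (le_max_right _ _)
  have key := time_lemma (fun t => m (max t 0)) (fun t => b (max t 0)) hmm hbb (by
    intro χ χ' hχ hχ'c ⟨C, hC⟩ ⟨T, hT, hT0⟩
    have hw := weak_test β Y hYcont M hM κ hprob hwk hweak q χ χ' hχ hχ'c C hC T hT hT0
    refine Eq.trans ?_ hw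
    rw [max_self]
    refine congrArg _ (setIntegral_congr_fun measurableSet_Ici fun t ht => ?_)
    beta_reduce
    rw [max_eq_left (Set.mem_Ici.1 ht)])
  have hd : HasDerivAt (fun t => m 0 + ∫ s in (0:ℝ)..t, b (max s 0)) (b (max t 0)) t :=
    (intervalIntegral.integral_hasDerivAt_right (hbb.intervalIntegrable _ _)
      hbb.aestronglyMeasurable.stronglyMeasurableAtFilter hbb.continuousAt).const_add _
  rw [max_eq_left ht] at hd
  refine (hd.hasDerivWithinAt (s := Set.Ici t)).congr (fun s hs => ?_) ?_
  · have h := key s (le_trans ht hs)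
    simp only [max_self, max_eq_left (le_trans ht hs)] at h
    exact h
  · have h := key t ht
    simp only [max_self, max_eq_left ht] at h
    exact h

open ProbabilityTheory

lemma gauss_cos {p : ℕ} (ξ : EuclideanSpace ℝ (Fin p)) (a : ℝ) :
    ∫ z, Real.cos (⟪z, ξ⟫ + a) ∂(stdGaussian (EuclideanSpace ℝ (Fin p))) =
      Real.cos a * Real.exp (-‖ξ‖^2/2) := by
  have h := charFun_stdGaussian ξ
  rw [charFun_apply] at h
  have hint : Integrable (fun z => Complex.exp (Complex.I * a) *
      Complex.exp (⟪z, ξ⟫ * Complex.I)) (stdGaussian (EuclideanSpace ℝ (Fin p))) := by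
    refine Integrable.of_bound (Continuous.aestronglyMeasurable (by fun_prop)) 1
      (Eventually.of_forall fun z => ?_)
    rw [norm_mul, mul_comm Complex.I, Complex.norm_exp_ofReal_mul_I, Complex.norm_exp_ofReal_mul_I]
    simp
  have h2 : ∫ z, Complex.exp (Complex.I * a) *
      Complex.exp (⟪z, ξ⟫ * Complex.I) ∂(stdGaussian (EuclideanSpace ℝ (Fin p))) =
      Complex.exp (Complex.I * a) * Complex.exp (-‖ξ‖^2/2) := by
    rw [integral_const_mul, h]
  have h3 := congrArg Complex.re h2
  rw [← RCLike.re_eq_complex_re, ← integral_re hint] at h3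
  simp only [RCLike.re_eq_complex_re] at h3
  have e1 : ∀ z : EuclideanSpace ℝ (Fin p), (Complex.exp (Complex.I * a) *
      Complex.exp (⟪z, ξ⟫ * Complex.I)).re = Real.cos (⟪z, ξ⟫ + a) := by
    intro z
    rw [← Complex.exp_add, mul_comm Complex.I, ← add_mul, ← Complex.ofReal_add,
      Complex.exp_ofReal_mul_I_re, add_comm]
  simp only [e1] at h3
  rw [h3]
  have e2 : Complex.exp (-(‖ξ‖:ℂ)^2/2) = ((Real.exp (-‖ξ‖^2/2) : ℝ) : ℂ) := by
    push_cast; rfl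
  rw [e2, Complex.re_mul_ofReal, mul_comm Complex.I, Complex.exp_ofReal_mul_I_re]

lemma gauss_stein {p : ℕ} (ξ v : EuclideanSpace ℝ (Fin p)) (a : ℝ) :
    ∫ z, Real.cos (⟪z, ξ⟫ + a) * ⟪z, v⟫ ∂(stdGaussian (EuclideanSpace ℝ (Fin p))) =
      -(Real.sin a * ⟪v, ξ⟫ * Real.exp (-‖ξ‖^2/2)) := by
  have hd := hasDerivAt_integral_of_dominated_loc_of_deriv_le
    (μ := stdGaussian (EuclideanSpace ℝ (Fin p))) (x₀ := (0:ℝ)) (s := Set.univ)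
    (F := fun h z => Real.cos (⟪z, ξ + h • v⟫ + (a - Real.pi/2)))
    (F' := fun h z => -Real.sin (⟪z, ξ + h • v⟫ + (a - Real.pi/2)) * ⟪z, v⟫)
    (bound := fun z => ‖z‖ * ‖v‖) Filter.univ_mem
    (Eventually.of_forall fun h => Continuous.aestronglyMeasurable (by fun_prop))
    (Integrable.of_bound (Continuous.aestronglyMeasurable (by fun_prop)) 1
      (Eventually.of_forall fun z => Real.abs_cos_le_one _))
    (Continuous.aestronglyMeasurable (by fun_prop))
    (Eventually.of_forall fun z h _ => by
      rw [norm_mul, norm_neg, Real.norm_eq_abs]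
      have h1 := Real.abs_sin_le_one (⟪z, ξ + h • v⟫ + (a - Real.pi/2))
      have h2 := norm_inner_le_norm (𝕜 := ℝ) z v
      calc _ ≤ 1 * (‖z‖ * ‖v‖) := by gcongr
        _ = _ := one_mul _)
    ((IsGaussian.integrable_id (μ := stdGaussian (EuclideanSpace ℝ (Fin p)))).norm.mul_const _)
    (Eventually.of_forall fun z h _ => by
      have : HasDerivAt (fun h : ℝ => ⟪z, ξ + h • v⟫ + (a - Real.pi/2)) ⟪z, v⟫ h := by
        have e : (fun h : ℝ => ⟪z, ξ + h • v⟫ + (a - Real.pi/2)) =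
          fun h : ℝ => h * ⟪z, v⟫ + (⟪z, ξ⟫ + (a - Real.pi/2)) := by
          ext h; rw [inner_add_right, inner_smul_right]; ring
        rw [e]
        simpa using ((hasDerivAt_id h).mul_const ⟪z, v⟫).add_const (⟪z, ξ⟫ + (a - Real.pi/2))
      exact this.cos)
  have h1 := hd.2
  simp only [gauss_cos] at h1
  have h2 : HasDerivAt (fun h : ℝ => Real.cos (a - Real.pi/2) * Real.exp (-‖ξ + h • v‖^2/2))
      (Real.cos (a - Real.pi/2) * (Real.exp (-‖ξ‖^2/2) * (-⟪v, ξ⟫))) 0 := by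
    have e : (fun h : ℝ => Real.cos (a - Real.pi/2) * Real.exp (-‖ξ + h • v‖^2/2)) =
      fun h : ℝ => Real.cos (a - Real.pi/2) * Real.exp (-(‖ξ‖^2 + 2 * h * ⟪v, ξ⟫ + h^2 * ‖v‖^2)/2) := by
      ext h
      rw [norm_add_sq_real, inner_smul_right, norm_smul, mul_pow, Real.norm_eq_abs, sq_abs,
        real_inner_comm]
      congr 3; ring
    rw [e]
    have hp : HasDerivAt (fun h : ℝ => -(‖ξ‖^2 + 2 * h * ⟪v, ξ⟫ + h^2 * ‖v‖^2)/2) (-⟪v, ξ⟫) 0 := by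
      have := (((((hasDerivAt_id (0:ℝ)).const_mul 2).mul_const ⟪v, ξ⟫).const_add (‖ξ‖^2)).add
        (((hasDerivAt_id (0:ℝ)).pow 2).mul_const (‖v‖^2))).neg.div_const 2
      exact this.congr_deriv (by simp; ring)
    have := hp.exp.const_mul (Real.cos (a - Real.pi/2))
    simpa using this
  have h3 := h1.unique h2
  rw [Real.cos_sub_pi_div_two] at h3
  have e4 : ∀ z : EuclideanSpace ℝ (Fin p), -Real.sin (⟪z, ξ + (0:ℝ) • v⟫ + (a - Real.pi/2)) =
      Real.cos (⟪z, ξ⟫ + a) := by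
    intro z
    rw [zero_smul, add_zero, ← add_sub_assoc, Real.sin_sub_pi_div_two, neg_neg]
  simp only [e4] at h3
  rw [h3]; ring

lemma grad_bound {p : ℕ} (c : (EuclideanSpace ℝ (Fin p) × ℝ) →₀ ℝ) (σ : ℝ) (hσ : 0 < σ)
    (K : ℝ) (hK : 0 ≤ K) (hf : ∀ x, |∑ q ∈ c.support, c q * trigF q x| ≤ K)
    (v x : EuclideanSpace ℝ (Fin p)) :
    |∑ q ∈ c.support, c q * (Real.exp (-(σ^2 * ‖q.1‖^2)/2) *
      (-(Real.sin (⟪q.1, x⟫ + q.2)) * ⟪v, q.1⟫))| ≤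
      K * ‖v‖ * (∫ z, ‖z‖ ∂(stdGaussian (EuclideanSpace ℝ (Fin p)))) / σ := by
  have hidn : Integrable (fun z : EuclideanSpace ℝ (Fin p) => ‖z‖)
    (stdGaussian (EuclideanSpace ℝ (Fin p))) := IsGaussian.integrable_id.norm
  have hone : ∀ q : EuclideanSpace ℝ (Fin p) × ℝ,
      Integrable (fun z => trigF q (x + σ • z) * ⟪z, v⟫)
        (stdGaussian (EuclideanSpace ℝ (Fin p))) ∧
      ∫ z, trigF q (x + σ • z) * ⟪z, v⟫ ∂(stdGaussian (EuclideanSpace ℝ (Fin p))) =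
      σ * (Real.exp (-(σ^2 * ‖q.1‖^2)/2) * (-(Real.sin (⟪q.1, x⟫ + q.2)) * ⟪v, q.1⟫)) := by
    intro q
    constructor
    · refine (hidn.mul_const ‖v‖).mono' (Continuous.aestronglyMeasurable
        (by unfold trigF; fun_prop)) (Eventually.of_forall fun z => ?_)
      rw [norm_mul]
      have h1 : ‖trigF q (x + σ • z)‖ ≤ 1 := Real.abs_cos_le_one _
      have h2 := norm_inner_le_norm (𝕜 := ℝ) z v
      calc _ ≤ 1 * (‖z‖ * ‖v‖) := by gcongr
        _ = _ := one_mul _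
    · have h := gauss_stein (σ • q.1) v (⟪q.1, x⟫ + q.2)
      rw [norm_smul, inner_smul_right, Real.norm_eq_abs, mul_pow, sq_abs] at h
      have e : ∀ z : EuclideanSpace ℝ (Fin p), Real.cos (⟪z, σ • q.1⟫ + (⟪q.1, x⟫ + q.2)) =
          trigF q (x + σ • z) := by
        intro z
        rw [trigF, inner_add_right, inner_smul_right, inner_smul_right, real_inner_comm z]
        congr 1; ring
      rw [integral_congr_ae (Eventually.of_forall fun z => congrArg (· * ⟪z, v⟫) (e z))] at h
      rw [h]; ring
  have hsum : ∫ z, (∑ q ∈ c.support, c q * trigF q (x + σ • z)) * ⟪z, v⟫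
      ∂(stdGaussian (EuclideanSpace ℝ (Fin p))) =
      σ * ∑ q ∈ c.support, c q * (Real.exp (-(σ^2 * ‖q.1‖^2)/2) *
      (-(Real.sin (⟪q.1, x⟫ + q.2)) * ⟪v, q.1⟫)) := by
    simp only [Finset.sum_mul, mul_assoc]
    rw [integral_finsetSum _ fun q _ => (hone q).1.const_mul (c q), Finset.mul_sum]
    refine Finset.sum_congr rfl fun q _ => ?_
    rw [integral_const_mul, (hone q).2]; ring
  have hb : ‖∫ z, (∑ q ∈ c.support, c q * trigF q (x + σ • z)) * ⟪z, v⟫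
      ∂(stdGaussian (EuclideanSpace ℝ (Fin p)))‖ ≤
      ∫ z, K * ‖v‖ * ‖z‖ ∂(stdGaussian (EuclideanSpace ℝ (Fin p))) := by
    apply norm_integral_le_of_norm_le (hidn.const_mul _)
    refine Eventually.of_forall fun z => ?_
    rw [norm_mul]
    have h1 := hf (x + σ • z)
    have h2 := norm_inner_le_norm (𝕜 := ℝ) z v
    calc _ ≤ K * (‖z‖ * ‖v‖) := by rw [Real.norm_eq_abs]; gcongr
      _ = _ := by ring
  rw [hsum, integral_const_mul, norm_mul, Real.norm_eq_abs, Real.norm_eq_abs, abs_of_pos hσ] at hb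
  rw [le_div_iff₀ hσ]; linarith
/-- uniqueness of weak solutions of the Fokker–Planck equation with a
bounded Lipschitz drift. -/
theorem stmt9 (p : ℕ) (hp : 1 ≤ p) (β : ℝ) (hβ : 0 < β)
    (Y : ℝ → EuclideanSpace ℝ (Fin p) → EuclideanSpace ℝ (Fin p))
    (hYcont : Continuous fun q : ℝ × EuclideanSpace ℝ (Fin p) => Y q.1 q.2)
    (hYbdd : ∃ M, ∀ t ∈ Set.Ici (0 : ℝ), ∀ x, ‖Y t x‖ ≤ M)
    (hYlip : ∃ K : ℝ≥0, ∀ t ∈ Set.Ici (0 : ℝ), LipschitzWith K (Y t))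
    (ν : Fin 2 → ℝ → Measure (EuclideanSpace ℝ (Fin p)))
    (hprob : ∀ i, ∀ t ∈ Set.Ici (0 : ℝ), IsProbabilityMeasure (ν i t))
    (hwkcont : ∀ i, ∀ f : EuclideanSpace ℝ (Fin p) → ℝ, Continuous f →
      (∃ C, ∀ x, |f x| ≤ C) →
      ContinuousOn (fun t => ∫ x, f x ∂(ν i t)) (Set.Ici (0 : ℝ)))
    (hweak : ∀ i, ∀ φ : ℝ → EuclideanSpace ℝ (Fin p) → ℝ,
      ContDiff ℝ 1 (fun q : ℝ × EuclideanSpace ℝ (Fin p) => φ q.1 q.2) →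
      (∀ t, ContDiff ℝ 2 (φ t)) →
      Continuous (fun q : ℝ × EuclideanSpace ℝ (Fin p) =>
        fderiv ℝ (fun y => gradient (φ q.1) y) q.2) →
      (∃ C, ∀ t x, |φ t x| ≤ C ∧ |deriv (fun s => φ s x) t| ≤ C ∧
        ‖gradient (φ t) x‖ ≤ C ∧ ‖fderiv ℝ (fun y => gradient (φ t) y) x‖ ≤ C) →
      (∃ T, 0 < T ∧ ∀ t, T ≤ t → ∀ x, φ t x = 0) →
      (∫ x, φ 0 x ∂(ν i 0)) +
        (∫ t in Set.Ici (0 : ℝ),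
          ∫ x, (deriv (fun s => φ s x) t + (1 / (2 * β)) * laplacian (φ t) x +
            ⟪Y t x, gradient (φ t) x⟫) ∂(ν i t)) = 0)
    (h0 : ν 0 0 = ν 1 0) :
    ∀ t ∈ Set.Ici (0 : ℝ), ν 0 t = ν 1 t := by
  obtain ⟨M, hM⟩ := hYbdd
  have hM0 : 0 ≤ M := (norm_nonneg _).trans (hM 0 Set.self_mem_Ici 0)
  have hd := fun i => weak_ode β Y hYcont M hM (ν i) (hprob i) (hwkcont i) (hweak i)
  set C0 := ∫ z, ‖z‖ ∂(stdGaussian (EuclideanSpace ℝ (Fin p))) with hC0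
  have hC0n : 0 ≤ C0 := integral_nonneg fun _ => norm_nonneg _
  set A := M * C0 * √β with hA
  have hA0 : 0 ≤ A := by positivity
  set δ := (1 / (4 * A + 1))^2 with hδ
  have hδ0 : 0 < δ := by positivity
  have hsδ : √δ = 1 / (4 * A + 1) := Real.sqrt_sq (by positivity)
  have hδA : 2 * A * √δ ≤ 1 / 2 := by
    rw [hsδ, mul_one_div, div_le_iff₀ (by positivity)]; linarith
  have half : ∀ t0, 0 ≤ t0 → ν 0 t0 = ν 1 t0 → ∀ S, 0 ≤ S →
      (∀ t ∈ Set.Icc t0 (t0 + δ), ∀ f ∈ trigT p, ∀ c : ℝ, 0 ≤ c → (∀ x, |f x| ≤ c) →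
        |∫ x, f x ∂(ν 0 t) - ∫ x, f x ∂(ν 1 t)| ≤ S * c) →
      (∀ t ∈ Set.Icc t0 (t0 + δ), ∀ f ∈ trigT p, ∀ c : ℝ, 0 ≤ c → (∀ x, |f x| ≤ c) →
        |∫ x, f x ∂(ν 0 t) - ∫ x, f x ∂(ν 1 t)| ≤ (S / 2) * c) := by
    intro t0 ht0 heq S hS hb T hT f hf K hK hfK
    obtain ⟨c, hc⟩ := (Finsupp.mem_span_range_iff_exists_finsupp).1 hf
    have hfx : ∀ x, f x = ∑ q ∈ c.support, c q * trigF q x := by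
      intro x
      rw [← hc, Finsupp.sum, Finset.sum_apply]
      rfl
    have htc : ∀ q, Continuous (trigF (p := p) q) := fun q => by unfold trigF; fun_prop
    have htb : ∀ (q : EuclideanSpace ℝ (Fin p) × ℝ) x, |trigF q x| ≤ 1 :=
      fun q x => Real.abs_cos_le_one _
    have hint : ∀ i, ∀ t ∈ Set.Ici (0:ℝ), ∀ f : EuclideanSpace ℝ (Fin p) → ℝ, Continuous f →
        ∀ C, (∀ x, |f x| ≤ C) → Integrable f (ν i t) := fun i t ht f hf C hC =>
      have := hprob i t ht
      Integrable.of_bound hf.aestronglyMeasurable C (Eventually.of_forall hC)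
    set w : EuclideanSpace ℝ (Fin p) × ℝ → ℝ → ℝ := fun q t =>
      Real.exp (-(1 / (2 * β) * ‖q.1‖^2) * (T - t)) with hw
    have hwd : ∀ q t, HasDerivAt (w q) (w q t * (1 / (2 * β) * ‖q.1‖^2)) t := by
      intro q t
      have := (((hasDerivAt_id t).const_sub T).const_mul (-(1 / (2 * β) * ‖q.1‖^2))).exp
      exact this.congr_deriv (by simp [hw])
    set m : Fin 2 → EuclideanSpace ℝ (Fin p) × ℝ → ℝ → ℝ :=
      fun i q t => ∫ x, trigF q x ∂(ν i t) with hm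
    set G : Fin 2 → EuclideanSpace ℝ (Fin p) × ℝ → ℝ → ℝ :=
      fun i q t => ∫ x, -(Real.sin (⟪q.1, x⟫ + q.2)) * ⟪Y t x, q.1⟫ ∂(ν i t) with hG
    set F : ℝ → ℝ := fun t => ∑ q ∈ c.support, c q * (w q t * (m 0 q t - m 1 q t)) with hF
    set F' : ℝ → ℝ := fun t => ∑ q ∈ c.support, c q * (w q t * (G 0 q t - G 1 q t)) with hF'
    have hsub : Set.Icc t0 T ⊆ Set.Ici 0 := fun x hx => le_trans ht0 hx.1
    have hmc : ∀ i q, ContinuousOn (m i q) (Set.Icc t0 T) := fun i q =>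
      (hwkcont i _ (htc q) ⟨1, htb q⟩).mono hsub
    have hwc : ∀ q, Continuous (w q) := fun q => by simp only [hw]; fun_prop
    have hFc : ContinuousOn F (Set.Icc t0 T) := by
      simp only [hF]
      exact continuousOn_finsetSum _ fun q _ => continuousOn_const.mul
        ((hwc q).continuousOn.mul ((hmc 0 q).sub (hmc 1 q)))
    have hFd : ∀ t ∈ Set.Ico t0 T, HasDerivWithinAt F (F' t) (Set.Ici t) t := by
      intro t ht
      have htt : 0 ≤ t := le_trans ht0 ht.1
      simp only [hF, hF']
      apply HasDerivWithinAt.fun_sum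
      intro q _
      have := (((hwd q t).hasDerivWithinAt (s := Set.Ici t)).mul
        ((hd 0 q t htt).sub (hd 1 q t htt))).const_mul (c q)
      refine this.congr_deriv ?_
      simp only [hm, hG, Pi.sub_apply]
      ring
    have hF'b : ∀ t ∈ Set.Ico t0 T, ‖F' t‖ ≤ A * S * K / √(T - t) := by
      intro t ht
      have htt : t ∈ Set.Ici (0:ℝ) := le_trans ht0 ht.1
      have hTt : 0 < T - t := by linarith [ht.2]
      have hYt : Continuous (Y t) := hYcont.comp (by fun_prop : Continuous fun x => (t, x))
      have := hprob 0 t htt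
      have := hprob 1 t htt
      set g : EuclideanSpace ℝ (Fin p) → ℝ := fun x => ∑ q ∈ c.support, c q * (w q t *
        (-(Real.sin (⟪q.1, x⟫ + q.2)) * ⟪Y t x, q.1⟫)) with hg
      have hone : ∀ q : EuclideanSpace ℝ (Fin p) × ℝ, ∀ i,
          Integrable (fun x => -(Real.sin (⟪q.1, x⟫ + q.2)) * ⟪Y t x, q.1⟫) (ν i t) := by
        intro q i
        refine hint i t htt _ (by fun_prop) (M * ‖q.1‖) fun x => ?_
        rw [abs_mul, abs_neg]
        have h1 := Real.abs_sin_le_one (⟪q.1, x⟫ + q.2)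
        have h2 := abs_real_inner_le_norm (Y t x) q.1
        calc _ ≤ 1 * (‖Y t x‖ * ‖q.1‖) := by gcongr
          _ ≤ _ := by rw [one_mul]; gcongr; exact hM t htt x
      have hgi : ∀ i, ∫ x, g x ∂(ν i t) = ∑ q ∈ c.support, c q * (w q t * G i q t) := by
        intro i
        simp only [hg]
        rw [integral_finsetSum _ fun q _ => ((hone q i).const_mul _).const_mul _]
        refine Finset.sum_congr rfl fun q _ => ?_
        rw [integral_const_mul, integral_const_mul]
      have hFg : F' t = ∫ x, g x ∂(ν 0 t) - ∫ x, g x ∂(ν 1 t) := by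
        rw [hgi, hgi, ← Finset.sum_sub_distrib]
        simp only [hF']
        refine Finset.sum_congr rfl fun q _ => ?_
        ring
      set σ := √((T - t) / β) with hσ
      have hσ0 : 0 < σ := Real.sqrt_pos.2 (by positivity)
      have hσ2 : σ^2 = (T - t) / β := Real.sq_sqrt (by positivity)
      have hσe : σ = √(T - t) / √β := Real.sqrt_div hTt.le β
      have hgb : ∀ x, |g x| ≤ A * K / √(T - t) := by
        intro x
        have h1 := grad_bound c σ hσ0 K hK (fun x => by rw [← hfx]; exact hfK x) (Y t x) x
        have e : ∀ q : EuclideanSpace ℝ (Fin p) × ℝ, w q t = Real.exp (-(σ^2 * ‖q.1‖^2)/2) := by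
          intro q
          simp only [hw]; rw [hσ2]; congr 1; field_simp
        simp only [hg, e]
        refine h1.trans ?_
        calc K * ‖Y t x‖ * C0 / σ ≤ K * M * C0 / σ := by gcongr; exact hM t htt x
          _ = A * K / √(T - t) := by
            rw [hσe, hA]; field_simp
      have := density (ν 0 t) (ν 1 t) S (hb t ⟨ht.1, by linarith [ht.2, hT.2]⟩) g
        (by simp only [hg]; fun_prop) (A * K / √(T - t)) (by positivity) hgb
      rw [hFg, Real.norm_eq_abs]
      refine this.trans (le_of_eq ?_)
      ring
    have hF0 : F t0 = 0 := by
      simp only [hF, hm, heq]; simp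
    have hfin := image_norm_le_of_norm_deriv_right_le_deriv_boundary' hFc hFd
      (B := fun t => 2 * A * S * K * (√(T - t0) - √(T - t)))
      (B' := fun t => A * S * K / √(T - t)) (by simp [hF0]) (by fun_prop)
      (by
        intro t ht
        have hTt : 0 < T - t := by linarith [ht.2]
        have := ((((hasDerivAt_id t).const_sub T).sqrt hTt.ne').const_sub
          (√(T - t0))).const_mul (2 * A * S * K)
        refine (this.congr_deriv ?_).hasDerivWithinAt
        simp only [id]
        field_simp) hF'b (Set.right_mem_Icc.2 hT.1)
    have hFT : F T = ∫ x, f x ∂(ν 0 T) - ∫ x, f x ∂(ν 1 T) := by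
      have hTT : T ∈ Set.Ici (0:ℝ) := le_trans ht0 hT.1
      have e : ∀ i, ∫ x, f x ∂(ν i T) = ∑ q ∈ c.support, c q * m i q T := by
        intro i
        simp only [hfx]
        rw [integral_finsetSum _ fun q _ => (hint i T hTT _ (htc q) 1 (htb q)).const_mul _]
        refine Finset.sum_congr rfl fun q _ => ?_
        rw [integral_const_mul]
      rw [e, e, ← Finset.sum_sub_distrib]
      simp only [hF]
      refine Finset.sum_congr rfl fun q _ => ?_
      simp [hw]; ring
    rw [hFT, Real.norm_eq_abs] at hfin
    refine hfin.trans ?_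
    have h1 : √(T - t0) ≤ √δ := Real.sqrt_le_sqrt (by linarith [hT.2])
    simp only [sub_self, Real.sqrt_zero, sub_zero]
    calc 2 * A * S * K * √(T - t0) ≤ 2 * A * S * K * √δ := by gcongr
      _ = (2 * A * √δ) * (S * K) := by ring
      _ ≤ 1 / 2 * (S * K) := by gcongr
      _ = _ := by ring
  have step : ∀ t0, 0 ≤ t0 → ν 0 t0 = ν 1 t0 → ∀ t ∈ Set.Icc t0 (t0 + δ), ν 0 t = ν 1 t := by
    intro t0 ht0 heq t ht
    have hn : ∀ n : ℕ, ∀ t ∈ Set.Icc t0 (t0 + δ), ∀ f ∈ trigT p, ∀ c : ℝ, 0 ≤ c →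
        (∀ x, |f x| ≤ c) → |∫ x, f x ∂(ν 0 t) - ∫ x, f x ∂(ν 1 t)| ≤ (2 * (1/2)^n) * c := by
      intro n
      induction n with
      | zero =>
        intro t ht f hf c hc hfc
        have htt : t ∈ Set.Ici (0:ℝ) := le_trans ht0 ht.1
        have hi : ∀ i, ‖∫ x, f x ∂(ν i t)‖ ≤ c := by
          intro i
          have := hprob i t htt
          have := norm_integral_le_of_norm_le_const (μ := ν i t)
            (Eventually.of_forall hfc : ∀ᵐ x ∂(ν i t), ‖f x‖ ≤ c)
          simpa using this
        have h1 := abs_sub (∫ x, f x ∂(ν 0 t)) (∫ x, f x ∂(ν 1 t))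
        have h2 := hi 0
        have h3 := hi 1
        rw [Real.norm_eq_abs] at h2 h3
        simp only [pow_zero]
        linarith
      | succ n ih =>
        have := half t0 ht0 heq _ (by positivity) ih
        have e : (2 * (1/2)^n / 2 : ℝ) = 2 * (1/2)^(n+1) := by ring
        rwa [e] at this
    have htt : t ∈ Set.Ici (0:ℝ) := le_trans ht0 ht.1
    have := hprob 0 t htt
    have := hprob 1 t htt
    apply ext_of_forall_integral_eq_of_IsFiniteMeasure
    intro g
    have hg := fun n => density (ν 0 t) (ν 1 t) _ (hn n t ht) g g.continuous ‖g‖ (norm_nonneg _)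
      g.norm_coe_le_norm
    have hlim : Tendsto (fun n : ℕ => (2 * (1/2 : ℝ)^n) * ‖g‖) atTop (𝓝 ((2 * 0) * ‖g‖)) :=
      ((tendsto_pow_atTop_nhds_zero_of_lt_one (by norm_num) (by norm_num)).const_mul 2).mul_const _
    have := ge_of_tendsto hlim (Eventually.of_forall hg)
    simp only [mul_zero, zero_mul] at this
    exact sub_eq_zero.1 (abs_nonpos_iff.1 this)
  have all : ∀ n : ℕ, ∀ t ∈ Set.Icc 0 (n * δ), ν 0 t = ν 1 t := by
    intro n
    induction n with
    | zero =>
      intro t ht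
      have : t = 0 := le_antisymm (by simpa using ht.2) ht.1
      rw [this, h0]
    | succ n ih =>
      intro t ht
      have hnn : 0 ≤ n * δ := by positivity
      by_cases h : t ≤ n * δ
      · exact ih t ⟨ht.1, h⟩
      · refine step (n * δ) hnn (ih _ ⟨hnn, le_rfl⟩) t ⟨by linarith, ?_⟩
        have := ht.2
        push_cast at this
        linarith
  intro t ht
  obtain ⟨n, hn⟩ := exists_nat_ge (t / δ)
  exact all n t ⟨ht, (div_le_iff₀ hδ0).1 hn⟩
end

section
/- Let p ≥ 1, a < b, δ ∈ [0, b − a], M ≥ 0 and K ≥ 0. Let Y₁, Y₂ : [a,b] × ℝ^p → ℝ^p be continuous with ‖Y₁(τ,z)‖ ≤ M and ‖Y₂(τ,z)‖ ≤ M for all (τ,z); assume Y₁(τ,·) = Y₂(τ,·) for every τ ∈ [a + δ, b], and that ‖Y₂(τ,z) − Y₂(τ,z′)‖ ≤ K·‖z − z′‖ for all τ ∈ [a,b] and all z, z′ ∈ ℝ^p. Let w, x, y : [a,b] → ℝ^p be continuous with x(a) = y(a) and, for all s ∈ [a,b], x(s) = x(a) + ∫_a^s Y₁(τ, x(τ))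 dτ + w(s) − w(a) and y(s) = y(a) + ∫_a^s Y₂(τ, y(τ)) dτ + w(s) − w(a). Then ‖x(s) − y(s)‖ ≤ 2·M·δ·exp(K·(b − a)) for all s ∈ [a,b]. -/
open MeasureTheory intervalIntegral

/-- a Gronwall-type estimate for two trajectories driven by the same noise
path, whose drifts agree after time `a + δ`. -/
theorem stmt10 (p : ℕ) (hp : 1 ≤ p) (a b δ M K : ℝ)
    (hab : a < b) (hδ : δ ∈ Set.Icc 0 (b - a)) (hM : 0 ≤ M) (hK : 0 ≤ K)
    (Y₁ Y₂ : ℝ → EuclideanSpace ℝ (Fin p) → EuclideanSpace ℝ (Fin p))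
    (hY₁cont : ContinuousOn (fun q : ℝ × EuclideanSpace ℝ (Fin p) => Y₁ q.1 q.2)
      (Set.Icc a b ×ˢ Set.univ))
    (hY₂cont : ContinuousOn (fun q : ℝ × EuclideanSpace ℝ (Fin p) => Y₂ q.1 q.2)
      (Set.Icc a b ×ˢ Set.univ))
    (hY₁bd : ∀ τ ∈ Set.Icc a b, ∀ z, ‖Y₁ τ z‖ ≤ M)
    (hY₂bd : ∀ τ ∈ Set.Icc a b, ∀ z, ‖Y₂ τ z‖ ≤ M)
    (hagree : ∀ τ ∈ Set.Icc (a + δ) b, Y₁ τ = Y₂ τ)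
    (hY₂lip : ∀ τ ∈ Set.Icc a b, ∀ z z', ‖Y₂ τ z - Y₂ τ z'‖ ≤ K * ‖z - z'‖)
    (w x y : ℝ → EuclideanSpace ℝ (Fin p))
    (hw : ContinuousOn w (Set.Icc a b))
    (hx : ContinuousOn x (Set.Icc a b))
    (hy : ContinuousOn y (Set.Icc a b))
    (hinit : x a = y a)
    (hxeq : ∀ s ∈ Set.Icc a b, x s = x a + (∫ τ in a..s, Y₁ τ (x τ)) + w s - w a)
    (hyeq : ∀ s ∈ Set.Icc a b, y s = y a + (∫ τ in a..s, Y₂ τ (y τ)) + w s - w a) :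
    ∀ s ∈ Set.Icc a b, ‖x s - y s‖ ≤ 2 * M * δ * Real.exp (K * (b - a)) := by
  obtain ⟨hδ0, hδ1⟩ := hδ
  have hg1 : ContinuousOn (fun τ => Y₁ τ (x τ)) (Set.Icc a b) :=
    hY₁cont.comp (f := fun τ => (τ, x τ)) (continuousOn_id.prodMk hx) (fun t ht => ⟨ht, trivial⟩)
  have hg2 : ContinuousOn (fun τ => Y₂ τ (y τ)) (Set.Icc a b) :=
    hY₂cont.comp (f := fun τ => (τ, y τ)) (continuousOn_id.prodMk hy) (fun t ht => ⟨ht, trivial⟩)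
  set g : ℝ → EuclideanSpace ℝ (Fin p) := fun τ => Y₁ τ (x τ) - Y₂ τ (y τ) with hg
  have hgc : ContinuousOn g (Set.Icc a b) := hg1.sub hg2
  set G : ℝ → EuclideanSpace ℝ (Fin p) := Set.IccExtend hab.le ((Set.Icc a b).restrict g) with hG
  have hGc : Continuous G := hgc.restrict.Icc_extend'
  have hGg : ∀ t ∈ Set.Icc a b, G t = g t := fun t ht => by
    rw [hG, Set.IccExtend_of_mem hab.le _ ht]; rfl
  have hf : ∀ s ∈ Set.Icc a b, x s - y s = ∫ τ in a..s, G τ := by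
    intro s hs
    have hsub : Set.uIcc a s ⊆ Set.Icc a b := by
      rw [Set.uIcc_of_le hs.1]; exact Set.Icc_subset_Icc_right hs.2
    have h1 : ∫ τ in a..s, G τ = ∫ τ in a..s, g τ :=
      intervalIntegral.integral_congr (fun t ht => hGg t (hsub ht))
    rw [h1, hg, intervalIntegral.integral_sub (hg1.mono hsub).intervalIntegrable
      (hg2.mono hsub).intervalIntegrable, hxeq s hs, hyeq s hs, hinit]
    abel
  have hGb : ∀ t ∈ Set.Icc a b, ‖G t‖ ≤ 2 * M := fun t ht => by
    rw [hGg t ht]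
    have := norm_sub_le (Y₁ t (x t)) (Y₂ t (y t))
    have := hY₁bd t ht (x t)
    have := hY₂bd t ht (y t)
    simp only [hg]
    linarith
  have hfirst : ∀ s ∈ Set.Icc a (a + δ), ‖∫ τ in a..s, G τ‖ ≤ 2 * M * δ := by
    intro s hs
    have h := intervalIntegral.norm_integral_le_of_norm_le_const (a := a) (b := s) (f := G)
      (C := 2 * M) (fun t ht => by
        rw [Set.uIoc_of_le hs.1] at ht
        exact hGb t ⟨ht.1.le, by linarith [ht.2, hs.2]⟩)
    rw [abs_of_nonneg (by linarith [hs.1])] at h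
    exact h.trans (mul_le_mul_of_nonneg_left (by linarith [hs.2]) (by positivity))
  have hd : ∀ s, HasDerivAt (fun s => ∫ τ in a..s, G τ) (G s) s := fun s =>
    hGc.integral_hasStrictDerivAt a s |>.hasDerivAt
  have hC : 0 ≤ 2 * M * δ := by positivity
  intro s hs
  rw [hf s hs]
  rcases le_total s (a + δ) with h | h
  · refine (hfirst s ⟨hs.1, h⟩).trans (le_mul_of_one_le_right hC (Real.one_le_exp ?_))
    exact mul_nonneg hK (by linarith)
  · have := norm_le_gronwallBound_of_norm_deriv_right_le (f := fun s => ∫ τ in a..s, G τ) (f' := G)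
      (δ := 2 * M * δ) (K := K) (ε := 0) (a := a + δ) (b := b)
      (fun t _ => (hd t).continuousAt.continuousWithinAt)
      (fun t _ => (hd t).hasDerivWithinAt)
      (hfirst _ ⟨by linarith, le_rfl⟩)
      (fun t ht => by
        have ht' : t ∈ Set.Icc a b := ⟨by linarith [ht.1], ht.2.le⟩
        rw [hGg t ht', ← hf t ht', add_zero]
        simp only [hg]
        rw [hagree t ⟨ht.1, ht.2.le⟩]
        exact hY₂lip t ht' _ _) s ⟨h, hs.2⟩
    rw [gronwallBound_ε0] at this
    refine this.trans (mul_le_mul_of_nonneg_left (Real.exp_le_exp.2 ?_) hC)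
    exact mul_le_mul_of_nonneg_left (by linarith [hs.2]) hK
end
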